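/- Let f ∈ 1 + T·ℤ[T] and let p, q be relatively prime positive integers such that there exist polynomials g₁, g₂, h₁, h₂ ∈ 1 + T·ℤ[T] with f(t) = g₁(t^p)·g₂(t^q) / (h₁(t^p)·h₂(t^q)) as rational functions. Then there exist polynomials f₁, f₂ ∈ 1 + T·ℤ[T] such that f(t) = f₁(t^p)·f₂(t^q). -/

import Mathlib

open Polynomial

namespace Polynomial

theorem contract_expand_comm {R : Type*} [CommSemiring R] {p q : ℕ} (hp : 0 < p) (hq : 0 < q)
    (hpq : p.Coprime q) (s : R[X]) :
    contract p (expand R q s) = expand R q (contract p s) := by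
  ext n
  rw [coeff_contract hp.ne', coeff_expand hq, coeff_expand hq, coeff_contract hp.ne']
  have h : q ∣ n * p ↔ q ∣ n := hpq.symm.dvd_mul_right
  by_cases hn : q ∣ n
  · rw [if_pos (h.2 hn), if_pos hn, Nat.div_mul_right_comm hn]
  · rw [if_neg (mt h.1 hn), if_neg hn]

/-- If `h(t ^ p)` divides `g(t ^ q)` with `p` and `q` coprime, then some polynomial in `t ^ (p * q)`
lies between them for divisibility. -/
theorem exists_dvd_expand_and_expand_dvd {K : Type*} [Field K] {p q : ℕ} (hp : 0 < p)
    (hq : 0 < q) (hpq : p.Coprime q) {g h : K[X]} (hg : g.coeff 0 ≠ 0)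
    (hdvd : expand K p h ∣ expand K q g) :
    ∃ w : K[X], h ∣ expand K q w ∧ expand K p w ∣ g := by
  let J : Ideal K[X] := (Ideal.span {expand K p h}).comap (expand K q)
  have mem_J (x : K[X]) : x ∈ J ↔ expand K p h ∣ expand K q x :=
    Ideal.mem_comap.trans Ideal.mem_span_singleton
  obtain ⟨s, hs⟩ := (IsPrincipalIdealRing.principal J).principal
  have mem_J' (x : K[X]) : x ∈ J ↔ s ∣ x := by
    rw [hs, Ideal.submodule_span_eq, Ideal.mem_span_singleton]
  have hsg : s ∣ g := (mem_J' g).1 ((mem_J g).2 hdvd)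
  obtain ⟨k, hk⟩ := (mem_J s).1 ((mem_J' s).2 dvd_rfl)
  have hw : expand K q (contract p s) = h * contract p k := by
    rw [← contract_expand_comm hp hq hpq, hk, mul_comm, contract_mul_expand hp.ne', mul_comm]
  have hs0 : s.coeff 0 ≠ 0 := by
    intro h0
    obtain ⟨c, rfl⟩ := hsg
    simp [mul_coeff_zero, h0] at hg
  have hsw : s ∣ expand K p (contract p s) := by
    refine (mem_J' _).1 ((mem_J _).2 ⟨expand K p (contract p k), ?_⟩)
    rw [expand_expand, mul_comm, ← expand_expand, hw, map_mul]
  have hw0 : expand K p (contract p s) ≠ 0 := by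
    intro h0
    apply hs0
    simpa [coeff_expand hp, coeff_contract hp.ne'] using congrArg (coeff · 0) h0
  have hdeg : (expand K p (contract p s)).natDegree ≤ s.natDegree := by
    refine natDegree_le_iff_coeff_eq_zero.2 fun n hn ↦ ?_
    rw [coeff_expand hp, coeff_contract hp.ne']
    split_ifs with hpn
    · rw [Nat.div_mul_cancel hpn, coeff_eq_zero_of_natDegree_lt hn]
    · rfl
  exact ⟨contract p s, ⟨_, hw⟩,
    (associated_of_dvd_of_natDegree_le hsw hw0 hdeg).dvd_iff_dvd_left.1 hsg⟩

theorem exists_eq_expand_mul_expand_of_isCoprime {K : Type*} [Field K] {p q : ℕ} (hp : 0 < p)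
    (hq : 0 < q) (hpq : p.Coprime q) {f g₁ g₂ h₁ h₂ : K[X]} (hg₁ : g₁.coeff 0 ≠ 0)
    (hg₂ : g₂.coeff 0 ≠ 0) (hh₁ : h₁ ≠ 0) (hh₂ : h₂ ≠ 0)
    (hc₁ : IsCoprime g₁ h₁) (hc₂ : IsCoprime g₂ h₂)
    (heq : f * (expand K p h₁ * expand K q h₂) = expand K p g₁ * expand K q g₂) :
    ∃ f₁ f₂ : K[X], f = expand K p f₁ * expand K q f₂ := by
  have hd₁ : expand K p h₁ ∣ expand K q g₂ :=
    ((isCoprime_expand hp.ne').2 hc₁.symm).dvd_of_dvd_mul_left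
      ⟨f * expand K q h₂, by rw [← heq]; ring⟩
  have hd₂ : expand K q h₂ ∣ expand K p g₁ :=
    ((isCoprime_expand hq.ne').2 hc₂.symm).dvd_of_dvd_mul_right
      ⟨f * expand K p h₁, by rw [← heq]; ring⟩
  obtain ⟨w₁, ⟨b₁, hb₁⟩, a₂, rfl⟩ := exists_dvd_expand_and_expand_dvd hp hq hpq hg₂ hd₁
  obtain ⟨w₂, ⟨b₂, hb₂⟩, a₁, rfl⟩ := exists_dvd_expand_and_expand_dvd hq hp hpq.symm hg₁ hd₂
  refine ⟨a₁ * b₁, a₂ * b₂, mul_right_cancel₀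
    (mul_ne_zero ((expand_ne_zero hp).2 hh₁) ((expand_ne_zero hq).2 hh₂)) ?_⟩
  have e₁ : expand K q (expand K p w₁) = expand K p h₁ * expand K p b₁ := by
    rw [expand_expand, mul_comm, ← expand_expand, hb₁, map_mul]
  have e₂ : expand K p (expand K q w₂) = expand K q h₂ * expand K q b₂ := by
    rw [expand_expand, mul_comm, ← expand_expand, hb₂, map_mul]
  rw [heq]
  simp only [map_mul, e₁, e₂]
  ring

theorem exists_eq_expand_mul_expand {K : Type*} [Field K] {p q : ℕ} (hp : 0 < p)
    (hq : 0 < q) (hpq : p.Coprime q) {f g₁ g₂ h₁ h₂ : K[X]} (hg₁ : g₁.coeff 0 ≠ 0)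
    (hg₂ : g₂.coeff 0 ≠ 0) (hh₁ : h₁ ≠ 0) (hh₂ : h₂ ≠ 0)
    (heq : f * (expand K p h₁ * expand K q h₂) = expand K p g₁ * expand K q g₂) :
    ∃ f₁ f₂ : K[X], f = expand K p f₁ * expand K q f₂ := by
  classical
  obtain ⟨x₁, y₁, hx₁, hy₁, hu₁⟩ := extract_gcd g₁ h₁
  obtain ⟨x₂, y₂, hx₂, hy₂, hu₂⟩ := extract_gcd g₂ h₂
  generalize gcd g₁ h₁ = d₁ at hx₁ hy₁
  generalize gcd g₂ h₂ = d₂ at hx₂ hy₂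
  subst hx₁ hy₁ hx₂ hy₂
  rw [mul_coeff_zero] at hg₁ hg₂
  refine exists_eq_expand_mul_expand_of_isCoprime hp hq hpq (right_ne_zero_of_mul hg₁)
    (right_ne_zero_of_mul hg₂) (right_ne_zero_of_mul hh₁) (right_ne_zero_of_mul hh₂)
    ((gcd_isUnit_iff _ _).1 hu₁) ((gcd_isUnit_iff _ _).1 hu₂)
    (mul_left_cancel₀ (mul_ne_zero ((expand_ne_zero hp).2 (left_ne_zero_of_mul hh₁))
      ((expand_ne_zero hq).2 (left_ne_zero_of_mul hh₂))) ?_)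
  simp only [map_mul] at heq
  linear_combination heq

/-- A version of Gauss's lemma for polynomials with constant coefficient `1`. -/
theorem exists_map_eq_of_dvd_of_coeff_zero_eq_one {R K : Type*} [CommRing R] [IsDomain R]
    [IsIntegrallyClosed R] [Field K] [Algebra R K] [IsFractionRing R K] {f : R[X]} {g : K[X]}
    (hf : f.coeff 0 = 1) (hg : g.coeff 0 = 1) (hdvd : g ∣ f.map (algebraMap R K)) :
    ∃ g' : R[X], g'.map (algebraMap R K) = g := by
  have hrev : (f.map (algebraMap R K)).reverse = f.reverse.map (algebraMap R K) := by
    rw [reverse, reverse, natDegree_map_eq_of_injective (IsFractionRing.injective R K),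
      reflect_map]
  have hfm : f.reverse.Monic := by
    rw [Monic, reverse_leadingCoeff, trailingCoeff, natTrailingDegree_eq_zero.2 (Or.inr (by simp [hf])),
      hf]
  have hgm : g.reverse.leadingCoeff = 1 := by
    rw [reverse_leadingCoeff, trailingCoeff, natTrailingDegree_eq_zero.2 (Or.inr (by simp [hg])),
      hg]
  have hgr : g.reverse ∣ f.reverse.map (algebraMap R K) := by
    obtain ⟨c, hc⟩ := hdvd
    exact ⟨c.reverse, by rw [← hrev, hc, reverse_mul_of_domain]⟩
  obtain ⟨g', hg'⟩ := IsIntegrallyClosed.eq_map_mul_C_of_dvd K hfm hgr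
  rw [hgm, C_1, mul_one] at hg'
  exact ⟨g'.reflect g.natDegree, by rw [← reflect_map, hg', reverse, reflect_reflect]⟩

theorem exists_map_eq_of_expand_dvd_of_coeff_zero_eq_one {R K : Type*} [CommRing R] [IsDomain R]
    [IsIntegrallyClosed R] [Field K] [Algebra R K] [IsFractionRing R K] {n : ℕ} (hn : 0 < n)
    {f : R[X]} {g : K[X]} (hf : f.coeff 0 = 1) (hg : g.coeff 0 = 1)
    (hdvd : expand K n g ∣ f.map (algebraMap R K)) :
    ∃ g' : R[X], g'.map (algebraMap R K) = g := by
  obtain ⟨a, ha⟩ := exists_map_eq_of_dvd_of_coeff_zero_eq_one hf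
    (by simpa [coeff_expand hn] using hg) hdvd
  exact ⟨contract n a, by rw [map_contract hn.ne', ha, contract_expand _ hn.ne']⟩

end Polynomial

theorem stmt_3 (f g₁ g₂ h₁ h₂ : Polynomial ℤ) (p q : ℕ) (hp : 0 < p) (hq : 0 < q)
    (hpq : Nat.Coprime p q)
    (hf : f.coeff 0 = 1) (hg₁ : g₁.coeff 0 = 1) (hg₂ : g₂.coeff 0 = 1)
    (hh₁ : h₁.coeff 0 = 1) (hh₂ : h₂.coeff 0 = 1)
    (heq : f * (h₁.comp (X ^ p) * h₂.comp (X ^ q)) = g₁.comp (X ^ p) * g₂.comp (X ^ q)) :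
    ∃ f₁ f₂ : Polynomial ℤ, f₁.coeff 0 = 1 ∧ f₂.coeff 0 = 1 ∧
      f = f₁.comp (X ^ p) * f₂.comp (X ^ q) := by
  simp only [← expand_eq_comp_X_pow] at heq ⊢
  let φ := algebraMap ℤ ℚ
  have hφ : Function.Injective φ := IsFractionRing.injective ℤ ℚ
  have coeff_map_ne {a : ℤ[X]} (ha : a.coeff 0 = 1) : (a.map φ).coeff 0 ≠ 0 := by
    simp [ha]
  have map_ne {a : ℤ[X]} (ha : a.coeff 0 = 1) : a.map φ ≠ 0 := fun h ↦
    coeff_map_ne ha (by rw [h, coeff_zero])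
  obtain ⟨A, B, hAB⟩ := exists_eq_expand_mul_expand (f := f.map φ) hp hq hpq
    (coeff_map_ne hg₁) (coeff_map_ne hg₂) (map_ne hh₁) (map_ne hh₂)
    (by simpa only [Polynomial.map_mul, map_expand] using congrArg (map φ) heq)
  have h0 : A.coeff 0 * B.coeff 0 = 1 := by
    simpa [hf, mul_coeff_zero, coeff_expand hp, coeff_expand hq] using
      (congrArg (coeff · 0) hAB).symm
  have hAB' : f.map φ =
      expand ℚ p (C (B.coeff 0) * A) * expand ℚ q (C (A.coeff 0) * B) := by
    have hC : C (A.coeff 0) * C (B.coeff 0) = (1 : ℚ[X]) := by rw [← C_mul, h0, C_1]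
    rw [map_mul, map_mul, expand_C, expand_C]
    linear_combination hAB - expand ℚ p A * expand ℚ q B * hC
  have hA : (C (B.coeff 0) * A).coeff 0 = 1 := by rw [coeff_C_mul, mul_comm, h0]
  have hB : (C (A.coeff 0) * B).coeff 0 = 1 := by rw [coeff_C_mul, h0]
  obtain ⟨f₁, hf₁⟩ := exists_map_eq_of_expand_dvd_of_coeff_zero_eq_one hp hf hA
    (Dvd.intro _ hAB'.symm)
  obtain ⟨f₂, hf₂⟩ := exists_map_eq_of_expand_dvd_of_coeff_zero_eq_one hq hf hB
    (Dvd.intro_left _ hAB'.symm)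
  refine ⟨f₁, f₂, hφ ?_, hφ ?_, map_injective φ hφ ?_⟩
  · rw [← coeff_map, hf₁, hA, map_one]
  · rw [← coeff_map, hf₂, hB, map_one]
  · rw [Polynomial.map_mul, map_expand, map_expand, hf₁, hf₂, hAB']
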